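/- Let x ∈ G with B(x) = ∅, let k ∈ A(x), and let δ ∈ ℝ^{J+1} satisfy δ_{J+1} = 0, δ_i ≤ 0 for i ∈ I(x), and δ_i = 0 for i ∉ I(x). Set p = −b_k + (δ_1,…,δ_J) ∈ ℝ^J. If p·γ_i > 0 for every i ∈ I(x), then H(p) ≤ 0. -/

import Mathlib

open Real

noncomputable section

/-- Euclidean dot product on `ℝ^J`. -/
def dotJ {J : ℕ} (p q : Fin J → ℝ) : ℝ := ∑ j, p j * q j

/-- `γ_i = e_i − e_{i+1}` for `i < J`, and `γ_J = e_J` (0-indexed). -/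
def gam (J : ℕ) (i : Fin J) : Fin J → ℝ :=
  fun j => (if j = i then (1 : ℝ) else 0) - (if (j : ℕ) = (i : ℕ) + 1 then (1 : ℝ) else 0)

/-- `b_i = β_i (e_1 + ⋯ + e_i)` (0-indexed: coordinates `j ≤ i`). -/
def bvec {J : ℕ} (β : Fin J → ℝ) (i : Fin J) : Fin J → ℝ :=
  fun j => if (j : ℕ) ≤ (i : ℕ) then β i else 0

/-- The domain `G`. -/
def domG {J : ℕ} [NeZero J] (z : Fin J → ℝ) : Set (Fin J → ℝ) :=
  {x | (∀ i, 0 ≤ x i) ∧ x 0 < z 0 ∧ ∀ i : Fin J, i ≠ 0 → x i ≤ z i}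

/-- The boundary portion `∂_o G`. -/
def bdO {J : ℕ} [NeZero J] (z : Fin J → ℝ) : Set (Fin J → ℝ) :=
  {x | x 0 = z 0 ∧ ∀ i : Fin J, i ≠ 0 → 0 ≤ x i ∧ x i ≤ z i}

/-- The boundary portion `∂_c G`. -/
def bdC {J : ℕ} [NeZero J] (z : Fin J → ℝ) : Set (Fin J → ℝ) :=
  {x | x ∈ domG z ∧ ∃ i : Fin J, i ≠ 0 ∧ x i = z i}

/-- The Hamiltonian `H(p) = c + λ(1 − e^{−p_1}) + Σ_i max(0, μ_i(1 − e^{γ_i·p}))`. -/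
def Ham {J : ℕ} [NeZero J] (lam c : ℝ) (μ : Fin J → ℝ) (p : Fin J → ℝ) : ℝ :=
  c + lam * (1 - Real.exp (-(p 0))) +
    ∑ i, max 0 (μ i * (1 - Real.exp (dotJ (gam J i) p)))

/-- Superdifferential of `V` at `x`, relative to the set `G`. -/
def supDiff {J : ℕ} (G : Set (Fin J → ℝ)) (V : (Fin J → ℝ) → ℝ) (x : Fin J → ℝ) :
    Set (Fin J → ℝ) :=
  {p | ∀ ε > 0, ∃ r > 0, ∀ y ∈ G, ‖y - x‖ < r →
    V y - V x - dotJ p (y - x) ≤ ε * ‖y - x‖}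

/-- Subdifferential of `V` at `x`, relative to the set `G`. -/
def subDiff {J : ℕ} (G : Set (Fin J → ℝ)) (V : (Fin J → ℝ) → ℝ) (x : Fin J → ℝ) :
    Set (Fin J → ℝ) :=
  {p | ∀ ε > 0, ∃ r > 0, ∀ y ∈ G, ‖y - x‖ < r →
    -(ε * ‖y - x‖) ≤ V y - V x - dotJ p (y - x)}

/-- `A' = {i : μ_i ≤ μ_j for all j < i}`. -/
def Aprime {J : ℕ} (μ : Fin J → ℝ) : Set (Fin J) := {i | ∀ j, j < i → μ i ≤ μ j}

/-- `A(x) = {i ∈ A' : i+1 ∉ B(x), or every j > i with [i+1,j] ⊆ B(x) has μ_i < μ_j}`. -/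
def Aset {J : ℕ} (μ z x : Fin J → ℝ) : Set (Fin J) :=
  {i | i ∈ Aprime μ ∧
    ((∀ h : (i : ℕ) + 1 < J, x ⟨(i : ℕ) + 1, h⟩ ≠ z ⟨(i : ℕ) + 1, h⟩) ∨
      ∀ j : Fin J, i < j → (∀ k : Fin J, i < k → k ≤ j → x k = z k) → μ i < μ j)}

/-- `l(x) = x log x − x + 1` (finite branch; `Real.log 0 = 0` gives `0·log 0 = 0`). -/
def lfun (x : ℝ) : ℝ := x * Real.log x - x + 1

/-- The control set `U = [0,1]^J`. -/
def Uset (J : ℕ) : Set (Fin J → ℝ) := {u | ∀ i, 0 ≤ u i ∧ u i ≤ 1}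

/-- The perturbation set `M = {(λ̄, μ̄) : λ̄ ≥ 0, μ̄_i ≥ 0}`. -/
def Mset (J : ℕ) : Set (ℝ × (Fin J → ℝ)) := {m | 0 ≤ m.1 ∧ ∀ i, 0 ≤ m.2 i}

/-- `H(p,u,m) = c + p·(λ̄ e_1 − Σ_i u_i μ̄_i γ_i) + λ l(λ̄/λ) + Σ_i u_i μ_i l(μ̄_i/μ_i)`. -/
def Hpum {J : ℕ} [NeZero J] (lam c : ℝ) (μ : Fin J → ℝ) (p u : Fin J → ℝ)
    (m : ℝ × (Fin J → ℝ)) : ℝ :=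
  c + dotJ p (fun j => m.1 * (if j = 0 then 1 else 0) - ∑ i, u i * m.2 i * gam J i j)
    + lam * lfun (m.1 / lam) + ∑ i, u i * (μ i * lfun (m.2 i / μ i))

/-- `h(ν,δ) = c + λ(1 − e^{Σ_i ν_i β_i − δ_1}) + Σ_i μ_i(1 − e^{−ν_i β_i + δ_i − δ_{i+1}})`,
with `ν ∈ ℝ^J` and `δ ∈ ℝ^{J+1}`. -/
def hFun {J : ℕ} (lam c : ℝ) (μ β : Fin J → ℝ)
    (q : (Fin J → ℝ) × (Fin (J + 1) → ℝ)) : ℝ :=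
  c + lam * (1 - Real.exp (∑ i, q.1 i * β i - q.2 0)) +
    ∑ i : Fin J, μ i * (1 - Real.exp (-(q.1 i * β i) + q.2 i.castSucc - q.2 i.succ))

/-- The constraint set `S` of pairs `(ν, δ)`. -/
def Sset {J : ℕ} (μ β z x : Fin J → ℝ) :
    Set ((Fin J → ℝ) × (Fin (J + 1) → ℝ)) :=
  {q | q.2 (Fin.last J) = 0 ∧
    (∀ i : Fin J, x i = 0 → 0 ≤ q.2 i.castSucc) ∧
    (∀ i : Fin J, x i = z i → q.2 i.castSucc ≤ 0) ∧
    (∀ i : Fin J, x i ≠ 0 → x i ≠ z i → q.2 i.castSucc = 0) ∧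
    (∀ i ∈ Aset μ z x, 0 ≤ q.1 i) ∧
    (∀ i ∉ Aset μ z x, q.1 i = 0) ∧
    (∑ i, q.1 i) = 1 ∧
    ∀ i : Fin J, -(q.1 i * β i) + q.2 i.castSucc - q.2 i.succ ≤ 0}

/-- `s` = largest (1-indexed) `j ≤ k` with `j ∉ I(x)`, and `s = 0` if none exists. -/
def sIdx {J : ℕ} (x : Fin J → ℝ) (k : Fin J) : ℕ :=
  sSup (insert 0 ((fun j : Fin J => (j : ℕ) + 1) '' {j | j ≤ k ∧ x j ≠ 0}))

/-- `t` = least (1-indexed) `j ∈ [k+1, J]` with `j ∉ B(x)`, and `t = J+1` if none exists. -/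
def tIdx {J : ℕ} (z x : Fin J → ℝ) (k : Fin J) : ℕ :=
  sInf (insert (J + 1) ((fun j : Fin J => (j : ℕ) + 1) '' {j | k < j ∧ x j ≠ z j}))

/-- `δ^{(r,k)}_i = β_k (1_{i ≥ r+1} − 1_{i ≥ k+1})` (1-indexed `i`, `r`; coordinates of
`Fin (J+1)` are the 1-indexed positions shifted by one). -/
def delrk {J : ℕ} (β : Fin J → ℝ) (k : Fin J) (r : ℕ) : Fin (J + 1) → ℝ :=
  fun i => β k * ((if r ≤ (i : ℕ) then 1 else 0) - (if (k : ℕ) + 1 ≤ (i : ℕ) then 1 else 0))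
theorem dotJ_comm' {J : ℕ} (p q : Fin J → ℝ) : dotJ p q = dotJ q p := by
  unfold dotJ
  exact Finset.sum_congr rfl fun j _ => mul_comm _ _

theorem dotJ_gam {J : ℕ} (β : Fin J → ℝ) (k : Fin J) (δ : Fin (J + 1) → ℝ)
    (hlast : δ (Fin.last J) = 0) (i : Fin J) :
    dotJ (fun j => -(bvec β k j) + δ j.castSucc) (gam J i)
      = (if i = k then -(β k) else 0) + δ i.castSucc - δ i.succ := by
  unfold dotJ gam
  simp only [mul_sub, Finset.sum_sub_distrib, mul_ite, mul_one, mul_zero,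
    Finset.sum_ite_eq', Finset.mem_univ, if_true]
  by_cases h : (i : ℕ) + 1 < J
  · have e : ∀ j : Fin J, ((j : ℕ) = (i : ℕ) + 1) ↔ j = ⟨(i : ℕ) + 1, h⟩ := by
      intro j
      rw [Fin.ext_iff]
    simp only [e, Finset.sum_ite_eq', Finset.mem_univ, if_true]
    have e2 : (⟨(i : ℕ) + 1, h⟩ : Fin J).castSucc = i.succ := by
      ext; simp
    rw [e2]
    unfold bvec
    simp only [Fin.ext_iff]
    split_ifs <;> first | omega | ring
  · have e : ∀ j : Fin J, ¬ ((j : ℕ) = (i : ℕ) + 1) := by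
      intro j; omega
    have e2 : i.succ = Fin.last J := by
      ext; simp; omega
    simp only [e, if_false, Finset.sum_const_zero, e2, hlast]
    unfold bvec
    simp only [Fin.ext_iff]
    split_ifs <;> first | omega | ring

/-- subsolution property — for `x ∈ G` with `B(x) = ∅`, `k ∈ A(x)`, and `δ`
supported on `I(x)` with `δ_i ≤ 0` there, if `p = −b_k + δ` satisfies `p·γ_i > 0` for all
`i ∈ I(x)`, then `H(p) ≤ 0`. -/
theorem stmt19 (J : ℕ) [NeZero J] (lam c : ℝ) (μ z β : Fin J → ℝ)
    (hlam : 0 < lam) (hc : 0 < c) (hμ : ∀ i, 0 < μ i) (hz : ∀ i, 0 < z i)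
    (hβ : ∀ i, 0 < β i ∧
      c + lam * (1 - Real.exp (β i)) + μ i * (1 - Real.exp (-(β i))) = 0)
    (x : Fin J → ℝ) (hx : x ∈ domG z) (hB : ∀ i, x i ≠ z i)
    (k : Fin J) (hk : k ∈ Aset μ z x)
    (δ : Fin (J + 1) → ℝ) (hlast : δ (Fin.last J) = 0)
    (hI : ∀ i : Fin J, x i = 0 → δ i.castSucc ≤ 0)
    (hO : ∀ i : Fin J, x i ≠ 0 → δ i.castSucc = 0)
    (hpos : ∀ i : Fin J, x i = 0 →
      0 < dotJ (fun j => -(bvec β k j) + δ j.castSucc) (gam J i)) :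
    Ham lam c μ (fun j => -(bvec β k j) + δ j.castSucc) ≤ 0 := by
  have hδ0 : ∀ i, 0 ≤ δ i := by
    intro i
    induction i using Fin.reverseInduction with
    | last => exact hlast.ge
    | cast i ih =>
      by_cases h : x i = 0
      · have h1 := hpos i h
        rw [dotJ_gam β k δ hlast i] at h1
        have h2 := (hβ k).1
        split_ifs at h1 <;> linarith
      · exact (hO i h).ge
  have hδ : ∀ i : Fin J, δ i.castSucc = 0 := by
    intro i
    by_cases h : x i = 0
    · exact le_antisymm (hI i h) (hδ0 _)
    · exact hO i h
  have hδs : ∀ i, δ i = 0 := by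
    intro i
    induction i using Fin.lastCases with
    | last => exact hlast
    | cast i => exact hδ i
  unfold Ham
  have hsum : ∑ i, max 0 (μ i * (1 - Real.exp
      (dotJ (gam J i) (fun j => -(bvec β k j) + δ j.castSucc))))
      = μ k * (1 - Real.exp (-(β k))) := by
    rw [Finset.sum_eq_single k]
    · rw [dotJ_comm', dotJ_gam β k δ hlast k]
      simp only [hδs, if_true, add_zero, sub_zero]
      apply max_eq_right
      apply mul_nonneg (hμ k).le
      have : Real.exp (-(β k)) ≤ 1 := Real.exp_le_one_iff.2 (by linarith [(hβ k).1])
      linarith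
    · intro i _ hik
      rw [dotJ_comm', dotJ_gam β k δ hlast i]
      simp [hδs, hik]
    · simp
  rw [hsum]
  have h0 : -(-(bvec β k 0) + δ (0 : Fin J).castSucc) = β k := by
    rw [hδ]
    simp [bvec]
  rw [h0]
  exact (hβ k).2.le
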